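/- Let X be a metrizable stratified space over a poset P, let J = [p_0 ≤ … ≤ p_n] be a flag in P and 0 < k < n. Let Q = {p_i : k ≤ i ≤ n} ⊆ P, a linearly ordered subposet. If the stratified subspace X_Q = s⁻¹(Q), with the induced stratification over Q, is categorically fibrant, then X has the horn filling property for the pair (J,k). -/

import Mathlib

open Set unitInterval

noncomputable section

/-! ### Stratified spaces over a poset -/

/-- Continuity into the Alexandrov topology on a preordered set: preimages of
upper sets are open. -/
def AlexContinuous {P : Type*} [Preorder P] {X : Type*} [TopologicalSpace X] (s : X → P) : Prop :=
  ∀ U : Set P, IsUpperSet U → IsOpen (s ⁻¹' U)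

lemma stdSimplex.exists_pos' {n : ℕ} (x : stdSimplex ℝ (Fin (n + 1))) :
    ∃ i, 0 < (x : Fin (n + 1) → ℝ) i := by
  by_contra h
  push_neg at h
  have h1 : ∑ i, (x : Fin (n + 1) → ℝ) i = 1 := x.2.2
  have h2 : ∑ i, (x : Fin (n + 1) → ℝ) i ≤ 0 := Finset.sum_nonpos fun i _ => h i
  linarith

/-- The largest index with positive barycentric coordinate. -/
def maxSupp {n : ℕ} (x : stdSimplex ℝ (Fin (n + 1))) : Fin (n + 1) :=
  (Finset.univ.filter fun i => 0 < (x : Fin (n + 1) → ℝ) i).max' (by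
    obtain ⟨i, hi⟩ := stdSimplex.exists_pos' x
    exact ⟨i, Finset.mem_filter.2 ⟨Finset.mem_univ i, hi⟩⟩)

/-- The stratification of the realized stratified simplex `|Δ^J|` of a flag `J`. -/
def flagStrat {P : Type*} {n : ℕ} (J : Fin (n + 1) → P) (x : stdSimplex ℝ (Fin (n + 1))) : P :=
  J (maxSupp x)

/-- The `k`-th horn of the standard `n`-simplex, as a subset of the simplex. -/
def hornSet (n : ℕ) (k : Fin (n + 1)) : Set (stdSimplex ℝ (Fin (n + 1))) :=
  {x | ∃ i, i ≠ k ∧ (x : Fin (n + 1) → ℝ) i = 0}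

/-- `X` (stratified by `s`) has the horn filling property with respect to the
realized stratified horn inclusion `|Λ^J_k| ↪ |Δ^J|`. -/
def HornFilling {P : Type*} {X : Type*} [TopologicalSpace X] (s : X → P) {n : ℕ}
    (J : Fin (n + 1) → P) (k : Fin (n + 1)) : Prop :=
  ∀ f : hornSet n k → X, Continuous f →
    (∀ y : hornSet n k, s (f y) = flagStrat J y.1) →
    ∃ g : stdSimplex ℝ (Fin (n + 1)) → X, Continuous g ∧
      (∀ x, s (g x) = flagStrat J x) ∧ ∀ y : hornSet n k, g y.1 = f y

/-- `(J, k)` is an inner horn datum. -/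
def IsInner (n : ℕ) (k : Fin (n + 1)) : Prop := 0 < (k : ℕ) ∧ (k : ℕ) < n

/-- `(J, k)` is an admissible horn datum. -/
def IsAdmissible {P : Type*} {n : ℕ} (J : Fin (n + 1) → P) (k : Fin (n + 1)) : Prop :=
  IsInner n k ∨
    ((k : ℕ) = 0 ∧ ∃ h : 0 < n, J ⟨0, Nat.succ_pos n⟩ = J ⟨1, Nat.succ_lt_succ h⟩) ∨
    ((k : ℕ) = n ∧ ∃ _h : 0 < n, J ⟨n - 1, by omega⟩ = J ⟨n, Nat.lt_succ_self n⟩)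

/-- A stratified space is categorically fibrant if it has the horn filling property
with respect to all inner stratified horn inclusions. -/
def CatFibrant {P : Type*} [Preorder P] {X : Type*} [TopologicalSpace X] (s : X → P) : Prop :=
  ∀ (n : ℕ) (J : Fin (n + 1) → P), Monotone J → ∀ k : Fin (n + 1), IsInner n k → HornFilling s J k

/-- A stratified space is diagrammatically fibrant if it has the horn filling property
with respect to all admissible stratified horn inclusions. -/
def DiagFibrant {P : Type*} [Preorder P] {X : Type*} [TopologicalSpace X] (s : X → P) : Prop :=
  ∀ (n : ℕ) (J : Fin (n + 1) → P), Monotone J → ∀ k : Fin (n + 1), IsAdmissible J k →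
    HornFilling s J k

/-! ### Exit paths and refinedness -/

/-- An exit path: `s ∘ γ` is constant on `(0, 1]` and does not decrease from `γ 0`. -/
def IsExitPath {P : Type*} [Preorder P] {X : Type*} [TopologicalSpace X]
    (s : X → P) (γ : C(I, X)) : Prop :=
  (∀ t t' : I, t ≠ 0 → t' ≠ 0 → s (γ t) = s (γ t')) ∧ ∀ t : I, s (γ 0) ≤ s (γ t)

/-- One step in a chain of exit paths. -/
def ExitStep {P : Type*} [Preorder P] {X : Type*} [TopologicalSpace X] (s : X → P)
    (x y : X) : Prop :=
  ∃ γ : C(I, X), IsExitPath s γ ∧ γ 0 = x ∧ γ 1 = y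

/-- A stratified space is refined if its stratification is surjective and the order
relation is exactly detected by finite chains of exit paths. -/
def IsRefined {P : Type*} [Preorder P] {X : Type*} [TopologicalSpace X] (s : X → P) : Prop :=
  Function.Surjective s ∧ ∀ x y : X, s x ≤ s y ↔ Relation.ReflTransGen (ExitStep s) x y

/-- The frontier relation: the `p`-stratum meets the closure of the `q`-stratum. -/
def FrontierRel {P : Type*} {X : Type*} [TopologicalSpace X] (s : X → P) (p q : P) : Prop :=
  (s ⁻¹' {p} ∩ closure (s ⁻¹' {q})).Nonempty

/-- Weakly frontier stratified. -/
def WeaklyFrontierStratified {P : Type*} [Preorder P] {X : Type*} [TopologicalSpace X]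
    (s : X → P) : Prop :=
  Function.Surjective s ∧ ∀ p q : P, p ≤ q ↔ Relation.ReflTransGen (FrontierRel s) p q

/-- Frontier stratified. -/
def FrontierStratified {P : Type*} [Preorder P] {X : Type*} [TopologicalSpace X]
    (s : X → P) : Prop :=
  WeaklyFrontierStratified s ∧ ∀ p q : P, FrontierRel s p q → s ⁻¹' {p} ⊆ closure (s ⁻¹' {q})

/-! ### Homotopy links -/

lemma I_one_ne_zero : (1 : I) ≠ 0 := fun h => one_ne_zero (α := ℝ) (congrArg Subtype.val h)

/-- The pairwise homotopy link of the pair of strata `p`, `q`. -/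
abbrev PairHolink {P : Type*} {X : Type*} [TopologicalSpace X] (s : X → P) (p q : P) :=
  {γ : C(I, X) // s (γ 0) = p ∧ ∀ t : I, t ≠ 0 → s (γ t) = q}

/-- Starting point evaluation on the pairwise homotopy link. -/
def pairHolinkEv0 {P : Type*} {X : Type*} [TopologicalSpace X] (s : X → P) (p q : P)
    (γ : PairHolink s p q) : {x : X // s x = p} :=
  ⟨γ.1 0, γ.2.1⟩

/-- A Serre fibration: a map with the homotopy lifting property with respect to all
Euclidean disks. -/
def IsSerreFibration {E B : Type*} [TopologicalSpace E] [TopologicalSpace B] (π : E → B) : Prop :=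
  ∀ (n : ℕ)
    (H : ↥(Metric.closedBall (0 : EuclideanSpace ℝ (Fin n)) 1) × I → B)
    (h₀ : ↥(Metric.closedBall (0 : EuclideanSpace ℝ (Fin n)) 1) → E),
    Continuous H → Continuous h₀ → (∀ d, π (h₀ d) = H (d, 0)) →
    ∃ G : ↥(Metric.closedBall (0 : EuclideanSpace ℝ (Fin n)) 1) × I → E,
      Continuous G ∧ (∀ d, G (d, 0) = h₀ d) ∧ ∀ z, π (G z) = H z

/-- The stratified homotopy link of the stratum `p`: exit paths starting in the
`p`-stratum and immediately leaving it. -/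
abbrev StratHolink {P : Type*} [Preorder P] {X : Type*} [TopologicalSpace X]
    (s : X → P) (p : P) :=
  {γ : C(I, X) // s (γ 0) = p ∧ (∀ t : I, t ≠ 0 → p < s (γ t)) ∧
    ∀ t t' : I, t ≠ 0 → t' ≠ 0 → s (γ t) = s (γ t')}

/-- The stratification of the stratified homotopy link over `P_{>p}`. -/
def stratHolinkStrat {P : Type*} [Preorder P] {X : Type*} [TopologicalSpace X]
    (s : X → P) (p : P) (γ : StratHolink s p) : {q : P // p < q} :=
  ⟨s (γ.1 1), γ.2.2.1 1 I_one_ne_zero⟩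

/-- Endpoint evaluation on the stratified homotopy link. -/
def stratHolinkEv1 {P : Type*} [Preorder P] {X : Type*} [TopologicalSpace X]
    (s : X → P) (p : P) (γ : StratHolink s p) : {x : X // p < s x} :=
  ⟨γ.1 1, γ.2.2.1 1 I_one_ne_zero⟩

/-- The generalized homotopy link of a (regular) flag `Iflag`: the space of stratified
maps `|Δ^Iflag| → X`, topologized via the compact-open topology. -/
abbrev Holink {P : Type*} {X : Type*} [TopologicalSpace X] (s : X → P) {m : ℕ}
    (Iflag : Fin (m + 1) → P) :=
  {f : C(stdSimplex ℝ (Fin (m + 1)), X) // ∀ x, s (f x) = flagStrat Iflag x}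

/-! ### Weak homotopy equivalences -/

/-- The boundary of the `n`-cube. -/
def cubeBoundary (n : ℕ) : Set (Fin n → I) := {y | ∃ i, y i = 0 ∨ y i = 1}

/-- Generalized loops: maps of the `n`-cube collapsing the boundary to the basepoint. -/
abbrev GenLoops (n : ℕ) (X : Type*) [TopologicalSpace X] (x : X) :=
  {p : C((Fin n → I), X) // ∀ y ∈ cubeBoundary n, p y = x}

/-- Homotopy rel boundary as a setoid on generalized loops. -/
def genLoopSetoid (n : ℕ) (X : Type*) [TopologicalSpace X] (x : X) :
    Setoid (GenLoops n X x) where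
  r p q := p.1.HomotopicRel q.1 (cubeBoundary n)
  iseqv := ⟨fun p => ContinuousMap.HomotopicRel.refl p.1,
    fun h => h.symm, fun h h' => h.trans h'⟩

/-- The `n`-th homotopy group (as a type) of `X` at `x`. -/
def HtpyGroup (n : ℕ) (X : Type*) [TopologicalSpace X] (x : X) :=
  Quotient (genLoopSetoid n X x)

/-- The map induced by a continuous map on homotopy groups. -/
def htpyGroupMap (n : ℕ) {X Y : Type*} [TopologicalSpace X] [TopologicalSpace Y]
    (f : C(X, Y)) (x : X) : HtpyGroup n X x → HtpyGroup n Y (f x) :=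
  Quotient.map (fun p => ⟨f.comp p.1, fun y hy => by
      simp [ContinuousMap.comp_apply, p.2 y hy]⟩)
    (fun p q h => h.map fun F => F.compContinuousMap f)

/-- The map induced by a continuous map on path components. -/
def pi0Map {X Y : Type*} [TopologicalSpace X] [TopologicalSpace Y] (f : C(X, Y)) :
    ZerothHomotopy X → ZerothHomotopy Y :=
  Quotient.map f fun _ _ h => ⟨h.somePath.map f.continuous⟩

/-- A weak homotopy equivalence: a continuous map inducing a bijection on path
components and isomorphisms on all homotopy groups at all basepoints. -/
def IsWeakHomotopyEquiv {X Y : Type*} [TopologicalSpace X] [TopologicalSpace Y]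
    (f : C(X, Y)) : Prop :=
  Function.Bijective (pi0Map f) ∧
    ∀ (n : ℕ) (x : X), Function.Bijective (htpyGroupMap (n + 1) f x)

/-! ### Induced maps and diagrammatic equivalences -/

/-- The map induced on generalized homotopy links by a stratified map. -/
def holinkCMap {P : Type*} {X Y : Type*} [TopologicalSpace X] [TopologicalSpace Y]
    (sX : X → P) (sY : Y → P) (w : C(X, Y)) (hw : ∀ x, sY (w x) = sX x)
    {m : ℕ} (Iflag : Fin (m + 1) → P) :
    C(Holink sX Iflag, Holink sY Iflag) :=
  ⟨fun f => ⟨w.comp f.1, fun x => by simp [ContinuousMap.comp_apply, hw, f.2 x]⟩,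
    Continuous.subtype_mk
      ((ContinuousMap.continuous_postcomp w).comp continuous_subtype_val) _⟩

/-- A stratified map is a diagrammatic equivalence if it induces weak homotopy
equivalences on all generalized homotopy links. -/
def IsDiagEquiv {P : Type*} [Preorder P] {X Y : Type*} [TopologicalSpace X] [TopologicalSpace Y]
    (sX : X → P) (sY : Y → P) (w : C(X, Y)) (hw : ∀ x, sY (w x) = sX x) : Prop :=
  ∀ (m : ℕ) (Iflag : Fin (m + 1) → P), StrictMono Iflag →
    IsWeakHomotopyEquiv (holinkCMap sX sY w hw Iflag)

/-- The restriction of a stratified map to the `q`-stratum. -/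
def stratumCMap {Q : Type*} {X Y : Type*} [TopologicalSpace X] [TopologicalSpace Y]
    (sX : X → Q) (sY : Y → Q) (w : C(X, Y)) (hw : ∀ x, sY (w x) = sX x) (q : Q) :
    C({x : X // sX x = q}, {y : Y // sY y = q}) :=
  ⟨fun x => ⟨w x.1, by rw [hw x.1]; exact x.2⟩,
    Continuous.subtype_mk (w.continuous.comp continuous_subtype_val)
      fun x => by show sY (w x.1) = q; rw [hw x.1]; exact x.2⟩

/-- The map induced on stratified homotopy links by a stratified map. -/
def stratHolinkCMap {P : Type*} [Preorder P] {X Y : Type*} [TopologicalSpace X]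
    [TopologicalSpace Y] {sX : X → P} {sY : Y → P} (w : C(X, Y))
    (hw : ∀ x, sY (w x) = sX x) (p : P) :
    C(StratHolink sX p, StratHolink sY p) :=
  ⟨fun γ => ⟨w.comp γ.1,
      by simpa [ContinuousMap.comp_apply, hw] using γ.2.1,
      fun t ht => by simpa [ContinuousMap.comp_apply, hw] using γ.2.2.1 t ht,
      fun t t' ht ht' => by simpa [ContinuousMap.comp_apply, hw] using γ.2.2.2 t t' ht ht'⟩,
    Continuous.subtype_mk
      ((ContinuousMap.continuous_postcomp w).comp continuous_subtype_val) _⟩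

lemma stratHolinkCMap_strat {P : Type*} [Preorder P] {X Y : Type*} [TopologicalSpace X]
    [TopologicalSpace Y] {sX : X → P} {sY : Y → P} (w : C(X, Y))
    (hw : ∀ x, sY (w x) = sX x) (p : P) (γ : StratHolink sX p) :
    stratHolinkStrat sY p (stratHolinkCMap w hw p γ) = stratHolinkStrat sX p γ :=
  Subtype.ext (hw _)

/-- The local homotopy link of `X` at `x ∈ X_p`: the fiber of the stratified homotopy
link over `x`. -/
abbrev LocalHolink {P : Type*} [Preorder P] {X : Type*} [TopologicalSpace X]
    (s : X → P) (p : P) (x : X) :=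
  {γ : StratHolink s p // (γ.1 : C(I, X)) 0 = x}

/-- The stratification of the local homotopy link over `P_{>p}`. -/
def localHolinkStrat {P : Type*} [Preorder P] {X : Type*} [TopologicalSpace X]
    (s : X → P) (p : P) (x : X) (γ : LocalHolink s p x) : {q : P // p < q} :=
  stratHolinkStrat s p γ.1

/-- The map induced on local homotopy links by a stratified map. -/
def localHolinkCMap {P : Type*} [Preorder P] {X Y : Type*} [TopologicalSpace X]
    [TopologicalSpace Y] {sX : X → P} {sY : Y → P} (w : C(X, Y))
    (hw : ∀ x, sY (w x) = sX x) (p : P) (x : X) :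
    C(LocalHolink sX p x, LocalHolink sY p (w x)) :=
  ⟨fun γ => ⟨stratHolinkCMap w hw p γ.1, by
      show (w.comp γ.1.1) 0 = w x
      simp [ContinuousMap.comp_apply, γ.2]⟩,
    Continuous.subtype_mk
      ((stratHolinkCMap w hw p).continuous.comp continuous_subtype_val)
      fun γ => by
        show (w.comp γ.1.1) 0 = w x
        simp [ContinuousMap.comp_apply, γ.2]⟩

lemma localHolinkCMap_strat {P : Type*} [Preorder P] {X Y : Type*} [TopologicalSpace X]
    [TopologicalSpace Y] {sX : X → P} {sY : Y → P} (w : C(X, Y))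
    (hw : ∀ x, sY (w x) = sX x) (p : P) (x : X) (γ : LocalHolink sX p x) :
    localHolinkStrat sY p (w x) (localHolinkCMap w hw p x γ) = localHolinkStrat sX p x γ :=
  Subtype.ext (hw _)

end

/-! ### Extension of partially defined stratified maps -/

/-- Every map defined on `D` and stratified with respect to `t` extends to one defined on `C`. -/
def StratExtends {P X Y : Type*} [TopologicalSpace X] [TopologicalSpace Y] (s : X → P)
    (t : Y → P) (D C : Set Y) : Prop :=
  ∀ h : Y → X, ContinuousOn h D → (∀ z ∈ D, s (h z) = t z) →
    ∃ g : Y → X, ContinuousOn g C ∧ (∀ z ∈ C, s (g z) = t z) ∧ EqOn g h D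

lemma exists_continuousOn_eq {X Y : Type*} [TopologicalSpace X] [TopologicalSpace Y] [Nonempty X]
    {A : Set Y} {f : A → X} (hf : Continuous f) :
    ∃ g : Y → X, ContinuousOn g A ∧ ∀ y : A, g y = f y := by
  have h : ∀ y : A, Function.extend Subtype.val f (fun _ => Classical.arbitrary X) y = f y :=
    fun y => Subtype.val_injective.extend_apply f _ y
  refine ⟨_, continuousOn_iff_continuous_domRestrict.2 ?_, h⟩
  exact hf.congr fun y => (h y).symm

/-- Gluing countably many extensions along the sublevel sets of a real function. -/
lemma StratExtends.of_slabs {P X Y : Type*} [TopologicalSpace X] [TopologicalSpace Y] {s : X → P}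
    {t : Y → P} {C D : Set Y} (hC : IsClosed C) (hD : IsClosed D) {u : Y → ℝ}
    (hu : Continuous u) (hu0 : ∀ z ∈ C, 0 ≤ u z) (huD : ∀ z ∈ C, u z = 0 → z ∈ D)
    (hext : ∀ j : ℕ, StratExtends s t
      {z ∈ C | (j : ℝ) ≤ u z ∧ u z ≤ j + 1 ∧ (z ∈ D ∨ u z = j)}
      {z ∈ C | (j : ℝ) ≤ u z ∧ u z ≤ j + 1}) :
    StratExtends s t D C := by
  classical
  intro h hh hs
  let T : ℕ → Set Y := fun j => D ∪ {z ∈ C | u z ≤ j}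
  let Good : ℕ → (Y → X) → Prop := fun j G =>
    ContinuousOn G (T j) ∧ (∀ z ∈ T j, s (G z) = t z) ∧ EqOn G h D
  have hTclosed : ∀ j, IsClosed (T j) := fun j =>
    hD.union (hC.inter (isClosed_le hu continuous_const))
  have hTmono : Monotone T := fun i j hij =>
    union_subset_union_right _ fun z hz => ⟨hz.1, hz.2.trans (by exact_mod_cast hij)⟩
  have step : ∀ j G, Good j G → ∃ G', Good (j + 1) G' ∧ EqOn G' G (T j) := by
    rintro j G ⟨hG, hGs, hGh⟩
    have hsub : {z ∈ C | (j : ℝ) ≤ u z ∧ u z ≤ j + 1 ∧ (z ∈ D ∨ u z = j)} ⊆ T j := by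
      rintro z ⟨hz, -, -, hz' | hz'⟩
      · exact Or.inl hz'
      · exact Or.inr ⟨hz, hz'.le⟩
    obtain ⟨g, hg, hgs, hgG⟩ := hext j G (hG.mono hsub) fun z hz => hGs z (hsub hz)
    let K : Set Y := {z ∈ C | (j : ℝ) ≤ u z ∧ u z ≤ j + 1}
    have hK : IsClosed K :=
      hC.inter ((isClosed_le continuous_const hu).inter (isClosed_le hu continuous_const))
    have hTK : T (j + 1) = T j ∪ K := by
      ext z
      simp only [T, K, mem_union, mem_ofPred_eq, Nat.cast_add, Nat.cast_one]
      constructor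
      · rintro (hz | ⟨hz, hz'⟩)
        · exact Or.inl (Or.inl hz)
        · rcases le_total (u z) j with h' | h'
          · exact Or.inl (Or.inr ⟨hz, h'⟩)
          · exact Or.inr ⟨hz, h', hz'⟩
      · rintro ((hz | ⟨hz, hz'⟩) | ⟨hz, -, hz'⟩)
        · exact Or.inl hz
        · exact Or.inr ⟨hz, by linarith⟩
        · exact Or.inr ⟨hz, hz'⟩
    have heqK : EqOn (K.piecewise g G) g K := piecewise_eqOn K g G
    have heqT : EqOn (K.piecewise g G) G (T j) := by
      intro z hz
      by_cases hzK : z ∈ K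
      · rw [heqK hzK]
        refine hgG ⟨hzK.1, hzK.2.1, hzK.2.2, ?_⟩
        rcases hz with hz | hz
        · exact Or.inl hz
        · exact Or.inr (le_antisymm hz.2 hzK.2.1)
      · exact piecewise_eq_of_notMem K g G hzK
    refine ⟨K.piecewise g G, ⟨?_, ?_, ?_⟩, heqT⟩
    · rw [hTK]
      exact (hG.congr heqT).union_of_isClosed (hg.congr heqK) (hTclosed j) hK
    · rw [hTK]
      rintro z (hz | hz)
      · rw [heqT hz, hGs z hz]
      · rw [heqK hz, hgs z hz]
    · exact fun z hz => (heqT (Or.inl hz)).trans (hGh hz)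
  have hT0 : T 0 = D := by
    refine union_eq_left.2 fun z hz => huD z hz.1 (le_antisymm ?_ (hu0 z hz.1))
    simpa using hz.2
  have good0 : Good 0 h := ⟨by rwa [hT0], by rwa [hT0], eqOn_refl _ _⟩
  choose next hnext hnextEq using step
  let seq : ∀ j : ℕ, {G : Y → X // Good j G} := fun j =>
    Nat.rec ⟨h, good0⟩ (fun j G => ⟨next j G.1 G.2, hnext j G.1 G.2⟩) j
  have hseq : ∀ i j, i ≤ j → EqOn (seq j).1 (seq i).1 (T i) := by
    intro i j hij
    induction j, hij using Nat.le_induction with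
    | base => exact eqOn_refl _ _
    | succ j hij ih =>
      exact fun z hz => (hnextEq j (seq j).1 (seq j).2 (hTmono hij hz)).trans (ih hz)
  have hmem : ∀ z ∈ C, z ∈ T ⌈u z⌉₊ := fun z hz => Or.inr ⟨hz, Nat.le_ceil _⟩
  have hlim : ∀ j, EqOn (fun z => (seq ⌈u z⌉₊).1 z) (seq j).1 {z ∈ C | u z ≤ j} := by
    rintro j z ⟨hz, hzj⟩
    exact (hseq _ _ (Nat.ceil_le.2 hzj) (hmem z hz)).symm
  refine ⟨fun z => (seq ⌈u z⌉₊).1 z, ?_, fun z hz => (seq _).2.2.1 z (hmem z hz),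
    fun z hz => (seq _).2.2.2 hz⟩
  intro z hz
  obtain ⟨N, hN⟩ := exists_nat_gt (u z)
  have hnhds : {z ∈ C | u z ≤ N} ∈ nhdsWithin z C :=
    Filter.inter_mem self_mem_nhdsWithin
      (mem_nhdsWithin_of_mem_nhds ((hu.continuousAt.eventually_lt continuousAt_const hN).mono
        fun _ h => le_of_lt h))
  have hcont : ContinuousWithinAt (fun z => (seq ⌈u z⌉₊).1 z) {z ∈ C | u z ≤ N} z :=
    (((seq N).2.1.mono subset_union_right).congr (hlim N)) z ⟨hz, hN.le⟩
  exact hcont.mono_of_mem_nhdsWithin hnhds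

/-! ### Orthants times simplices -/

/-- The largest index `i ≥ k` such that `i = k` or `z i > 0`. -/
noncomputable def topIndex {n : ℕ} (k : Fin (n + 1)) (z : Fin (n + 1) → ℝ) : Fin (n + 1) :=
  k ⊔ (Finset.univ.filter fun i => k < i ∧ 0 < z i).sup id

lemma topIndex_congr {n : ℕ} {k : Fin (n + 1)} {z z' : Fin (n + 1) → ℝ}
    (h : ∀ i, k < i → (0 < z i ↔ 0 < z' i)) : topIndex k z = topIndex k z' := by
  unfold topIndex
  congr 2
  ext i
  simp only [Finset.mem_filter, Finset.mem_univ, true_and]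
  exact and_congr_right (h i)

lemma le_maxSupp {n : ℕ} (x : stdSimplex ℝ (Fin (n + 1))) {i : Fin (n + 1)}
    (h : 0 < (x : Fin (n + 1) → ℝ) i) : i ≤ maxSupp x :=
  Finset.le_max' _ _ (by simpa using h)

lemma maxSupp_pos {n : ℕ} (x : stdSimplex ℝ (Fin (n + 1))) :
    0 < (x : Fin (n + 1) → ℝ) (maxSupp x) := by
  have h : maxSupp x ∈ Finset.univ.filter fun i => 0 < (x : Fin (n + 1) → ℝ) i :=
    Finset.max'_mem _ _
  simpa using h

lemma maxSupp_sup {n : ℕ} (x : stdSimplex ℝ (Fin (n + 1))) (k : Fin (n + 1)) :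
    maxSupp x ⊔ k = topIndex k x := by
  apply le_antisymm
  · refine sup_le ?_ le_sup_left
    rcases le_or_gt (maxSupp x) k with h | h
    · exact h.trans le_sup_left
    · exact (Finset.le_sup (f := id) (by simpa using ⟨h, maxSupp_pos x⟩)).trans le_sup_right
  · refine sup_le le_sup_right ((Finset.sup_le fun i hi => ?_).trans le_sup_left)
    exact le_maxSupp x (Finset.mem_filter.1 hi).2.2

/-- The product of the intervals `[a i, a i + 1]`, or `[a i, ∞)` if `i ∈ S`, for `i < k`, with
the standard simplex on the vertices `i ≥ k`. -/
def prism {n : ℕ} (k : Fin (n + 1)) (S : Finset (Fin (n + 1))) (a : Fin (n + 1) → ℝ) :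
    Set (Fin (n + 1) → ℝ) :=
  {z | (∀ i, i ≠ k → a i ≤ z i) ∧ (∀ i, i < k → i ∉ S → z i ≤ a i + 1) ∧ 0 ≤ z k ∧
    ∑ i ∈ Finset.Ici k, z i = 1}

/-- The points of a prism lying on some lower face. -/
def prismHorn {n : ℕ} (k : Fin (n + 1)) (S : Finset (Fin (n + 1))) (a : Fin (n + 1) → ℝ) :
    Set (Fin (n + 1) → ℝ) :=
  {z ∈ prism k S a | ∃ i, i ≠ k ∧ z i = a i}

lemma isClosed_prism {n : ℕ} (k : Fin (n + 1)) (S : Finset (Fin (n + 1)))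
    (a : Fin (n + 1) → ℝ) : IsClosed (prism k S a) := by
  simp only [prism, ofPred_and, ofPred_forall]
  refine IsClosed.inter ?_ (IsClosed.inter ?_ (IsClosed.inter ?_ ?_))
  · exact isClosed_iInter fun i => isClosed_iInter fun _ =>
      isClosed_le continuous_const (continuous_apply i)
  · exact isClosed_iInter fun i => isClosed_iInter fun _ => isClosed_iInter fun _ =>
      isClosed_le (continuous_apply i) continuous_const
  · exact isClosed_le continuous_const (continuous_apply k)
  · exact isClosed_eq (by fun_prop) continuous_const

lemma isClosed_prismHorn {n : ℕ} (k : Fin (n + 1)) (S : Finset (Fin (n + 1)))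
    (a : Fin (n + 1) → ℝ) : IsClosed (prismHorn k S a) := by
  refine (isClosed_prism k S a).inter ?_
  change IsClosed {z : Fin (n + 1) → ℝ | ∃ i, i ≠ k ∧ z i = a i}
  rw [ofPred_exists]
  refine isClosed_iUnion_of_finite fun i => ?_
  by_cases hi : i = k
  · simp [hi]
  · simpa [hi] using isClosed_eq (continuous_apply i) continuous_const

lemma sum_Ici_eq_add {n : ℕ} (k : Fin (n + 1)) (z : Fin (n + 1) → ℝ) :
    ∑ i ∈ Finset.Ici k, z i = z k + ∑ i ∈ Finset.Ioi k, z i := by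
  rw [← Finset.Ioi_insert, Finset.sum_insert (by simp)]

/-- The affine embedding of the bounded prism at `a` into the standard simplex. -/
noncomputable def prismToSimplex {n : ℕ} (k : Fin (n + 1)) (a z : Fin (n + 1) → ℝ) : Fin (n + 1) → ℝ :=
  fun i => if i = k then 1 - ∑ j ∈ Finset.univ.erase k, (z j - a j) / (n + 1)
    else (z i - a i) / (n + 1)

/-- A left inverse of `prismToSimplex`. -/
noncomputable def simplexToPrism {n : ℕ} (k : Fin (n + 1)) (a x : Fin (n + 1) → ℝ) : Fin (n + 1) → ℝ :=
  fun i => if i < k then a i + min 1 ((n + 1) * x i)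
    else if i = k then
      1 - ∑ j ∈ Finset.Ioi k, (n + 1) * x j / max 1 (∑ l ∈ Finset.Ioi k, (n + 1) * x l)
    else (n + 1) * x i / max 1 (∑ l ∈ Finset.Ioi k, (n + 1) * x l)

lemma continuous_prismToSimplex {n : ℕ} (k : Fin (n + 1)) (a : Fin (n + 1) → ℝ) :
    Continuous (prismToSimplex k a) := by
  refine continuous_pi fun i => ?_
  unfold prismToSimplex
  split_ifs <;> fun_prop

lemma continuous_simplexToPrism {n : ℕ} (k : Fin (n + 1)) (a : Fin (n + 1) → ℝ) :
    Continuous (simplexToPrism k a) := by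
  have hmax : ∀ x : Fin (n + 1) → ℝ, max 1 (∑ l ∈ Finset.Ioi k, ((n : ℝ) + 1) * x l) ≠ 0 :=
    fun x => (zero_lt_one.trans_le (le_max_left _ _)).ne'
  refine continuous_pi fun i => ?_
  unfold simplexToPrism
  split_ifs
  · fun_prop
  · exact continuous_const.sub (continuous_finsetSum _ fun j _ =>
      Continuous.div (by fun_prop) (by fun_prop) hmax)
  · exact Continuous.div (by fun_prop) (by fun_prop) hmax

lemma prismToSimplex_mem {n : ℕ} {k : Fin (n + 1)} {a z : Fin (n + 1) → ℝ}
    (ha : ∀ i, k < i → a i = 0) (hz : z ∈ prism k ∅ a) :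
    prismToSimplex k a z ∈ stdSimplex ℝ (Fin (n + 1)) := by
  obtain ⟨hlo, hup, hk, hsum⟩ := hz
  have hn : (0 : ℝ) < n + 1 := by positivity
  have hup' : ∀ j ∈ Finset.univ.erase k, (z j - a j) / ((n : ℝ) + 1) ≤ 1 / (n + 1) := by
    intro j hj
    gcongr
    rcases lt_or_gt_of_ne (Finset.ne_of_mem_erase hj) with h | h
    · linarith [hup j h (by simp)]
    · have h0 : ∀ i ∈ Finset.Ici k, 0 ≤ z i := by
        intro i hi
        rcases (Finset.mem_Ici.1 hi).eq_or_lt with rfl | hi'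
        · exact hk
        · exact ha i hi' ▸ hlo i hi'.ne'
      have := Finset.single_le_sum h0 (Finset.mem_Ici.2 h.le)
      rw [ha j h]
      linarith
  constructor
  · intro i
    unfold prismToSimplex
    split_ifs with hi
    · have h := Finset.sum_le_sum hup'
      rw [Finset.sum_const, Finset.card_erase_of_mem (Finset.mem_univ k), Finset.card_univ,
        Fintype.card_fin, Nat.add_sub_cancel, nsmul_eq_mul, mul_one_div] at h
      have : (n : ℝ) / (n + 1) ≤ 1 := (div_le_one hn).2 (by linarith)
      linarith
    · exact div_nonneg (by linarith [hlo i hi]) hn.le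
  · rw [← Finset.add_sum_erase _ _ (Finset.mem_univ k)]
    have h : ∑ i ∈ Finset.univ.erase k, prismToSimplex k a z i =
        ∑ i ∈ Finset.univ.erase k, (z i - a i) / ((n : ℝ) + 1) :=
      Finset.sum_congr rfl fun i hi => if_neg (Finset.ne_of_mem_erase hi)
    rw [h]
    simp [prismToSimplex]

lemma simplexToPrism_prismToSimplex {n : ℕ} {k : Fin (n + 1)} {a z : Fin (n + 1) → ℝ}
    (ha : ∀ i, k < i → a i = 0) (hz : z ∈ prism k ∅ a) :
    simplexToPrism k a (prismToSimplex k a z) = z := by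
  obtain ⟨hlo, hup, hk, hsum⟩ := hz
  have hn : (0 : ℝ) < n + 1 := by positivity
  have hc : ∀ i, i ≠ k → ((n : ℝ) + 1) * prismToSimplex k a z i = z i - a i := by
    intro i hi
    rw [prismToSimplex, if_neg hi]
    field_simp
  have hIoi : ∀ i ∈ Finset.Ioi k, ((n : ℝ) + 1) * prismToSimplex k a z i = z i := by
    intro i hi
    have hi := Finset.mem_Ioi.1 hi
    rw [hc i hi.ne', ha i hi, sub_zero]
  rw [sum_Ici_eq_add] at hsum
  have hmax : max 1 (∑ l ∈ Finset.Ioi k, ((n : ℝ) + 1) * prismToSimplex k a z l) = 1 := by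
    rw [Finset.sum_congr rfl hIoi]
    exact max_eq_left (by linarith)
  ext i
  unfold simplexToPrism
  simp only [hmax, div_one]
  rw [Finset.sum_congr rfl hIoi]
  split_ifs with h1 h2
  · rw [hc i h1.ne, min_eq_right (by linarith [hup i h1 (by simp)])]
    ring
  · subst h2
    linarith
  · exact hIoi i (Finset.mem_Ioi.2 (lt_of_le_of_ne (not_lt.1 h1) (Ne.symm h2)))

lemma simplexToPrism_mem {n : ℕ} {k : Fin (n + 1)} {a x : Fin (n + 1) → ℝ}
    (ha : ∀ i, k < i → a i = 0) (hx : ∀ i, 0 ≤ x i) : simplexToPrism k a x ∈ prism k ∅ a := by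
  have hn : (0 : ℝ) < n + 1 := by positivity
  have hmax : (0 : ℝ) < max 1 (∑ l ∈ Finset.Ioi k, ((n : ℝ) + 1) * x l) :=
    zero_lt_one.trans_le (le_max_left _ _)
  have hk : simplexToPrism k a x k = 1 - ∑ j ∈ Finset.Ioi k,
      (n + 1) * x j / max 1 (∑ l ∈ Finset.Ioi k, (n + 1) * x l) := by
    simp [simplexToPrism]
  refine ⟨fun i hi => ?_, fun i hi _ => ?_, ?_, ?_⟩
  · rcases lt_or_gt_of_ne hi with h | h
    · have : 0 ≤ min 1 (((n : ℝ) + 1) * x i) := le_min zero_le_one (mul_nonneg hn.le (hx i))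
      simp only [simplexToPrism, if_pos h]
      linarith
    · simp only [simplexToPrism, if_neg h.not_gt, if_neg hi, ha i h]
      exact div_nonneg (mul_nonneg hn.le (hx i)) hmax.le
  · have : min 1 (((n : ℝ) + 1) * x i) ≤ 1 := min_le_left _ _
    simp only [simplexToPrism, if_pos hi]
    linarith
  · rw [hk, ← Finset.sum_div, sub_nonneg, div_le_one hmax]
    exact le_max_right _ _
  · rw [sum_Ici_eq_add, hk]
    have : ∀ i ∈ Finset.Ioi k, simplexToPrism k a x i =
        (n + 1) * x i / max 1 (∑ l ∈ Finset.Ioi k, (n + 1) * x l) := by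
      intro i hi
      have hi := Finset.mem_Ioi.1 hi
      simp only [simplexToPrism, if_neg hi.not_gt, if_neg hi.ne']
    rw [Finset.sum_congr rfl this, sub_add_cancel]

lemma topIndex_simplexToPrism {n : ℕ} {k : Fin (n + 1)} {a x : Fin (n + 1) → ℝ} :
    topIndex k (simplexToPrism k a x) = topIndex k x := by
  have hmax : (0 : ℝ) < max 1 (∑ l ∈ Finset.Ioi k, ((n : ℝ) + 1) * x l) :=
    zero_lt_one.trans_le (le_max_left _ _)
  have hn : (0 : ℝ) < n + 1 := by positivity
  refine topIndex_congr fun i hi => ?_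
  simp only [simplexToPrism, if_neg hi.not_gt, if_neg hi.ne', div_pos_iff_of_pos_right hmax,
    mul_pos_iff_of_pos_left hn]

lemma stratExtends_prism_of_hornFilling {P X : Type*} [TopologicalSpace X] [Nonempty X] {s : X → P}
    {n : ℕ} {J : Fin (n + 1) → P} {k : Fin (n + 1)}
    (hfill : HornFilling s (fun i => J (i ⊔ k)) k) {a : Fin (n + 1) → ℝ}
    (ha : ∀ i, k < i → a i = 0) :
    StratExtends s (fun z => J (topIndex k z)) (prismHorn k ∅ a) (prism k ∅ a) := by
  intro h hh hhs
  have hmem : ∀ y : hornSet n k, simplexToPrism k a y.1 ∈ prismHorn k ∅ a := by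
    rintro ⟨y, i, hi, hyi⟩
    refine ⟨simplexToPrism_mem ha y.2.1, i, hi, ?_⟩
    rcases lt_or_gt_of_ne hi with h | h
    · simp [simplexToPrism, h, hyi]
    · simp [simplexToPrism, h.not_gt, hi, hyi, ha i h]
  obtain ⟨F, hF, hFs, hFh⟩ := hfill (fun y => h (simplexToPrism k a y.1))
    (hh.comp_continuous ((continuous_simplexToPrism k a).comp
      (continuous_subtype_val.comp continuous_subtype_val)) hmem)
    (fun y => by
      rw [hhs _ (hmem y), flagStrat, maxSupp_sup]
      exact congrArg J topIndex_simplexToPrism)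
  obtain ⟨G, hG, hGF⟩ := exists_continuousOn_eq hF
  refine ⟨fun z => G (prismToSimplex k a z), ?_, fun z hz => ?_, ?_⟩
  · exact hG.comp (continuous_prismToSimplex k a).continuousOn
      fun z hz => prismToSimplex_mem ha hz
  · have h1 := hGF ⟨_, prismToSimplex_mem ha hz⟩
    have h2 : topIndex k (prismToSimplex k a z) = topIndex k z := by
      rw [← topIndex_simplexToPrism (a := a), simplexToPrism_prismToSimplex ha hz]
    refine (congrArg s h1).trans ((hFs _).trans ?_)
    rw [flagStrat, maxSupp_sup]
    exact congrArg J h2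
  · rintro z ⟨hz, i, hi, hzi⟩
    have h1 := hGF ⟨_, prismToSimplex_mem ha hz⟩
    have h2 := hFh ⟨⟨_, prismToSimplex_mem ha hz⟩, i, hi, by
      change prismToSimplex k a z i = 0
      simp [prismToSimplex, hi, hzi]⟩
    refine (h1.trans h2).trans ?_
    exact congrArg h (simplexToPrism_prismToSimplex ha hz)

lemma stratExtends_prism {P X : Type*} [TopologicalSpace X] [Nonempty X] {s : X → P}
    {n : ℕ} {J : Fin (n + 1) → P} {k : Fin (n + 1)}
    (hfill : HornFilling s (fun i => J (i ⊔ k)) k) (S : Finset (Fin (n + 1)))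
    (hS : ∀ i ∈ S, i < k) {a : Fin (n + 1) → ℝ} (ha : ∀ i, k < i → a i = 0) :
    StratExtends s (fun z => J (topIndex k z)) (prismHorn k S a) (prism k S a) := by
  induction S using Finset.induction_on generalizing a with
  | empty => exact stratExtends_prism_of_hornFilling hfill ha
  | insert r S hr ih =>
    have hrk : r < k := hS r (by simp)
    refine StratExtends.of_slabs (isClosed_prism _ _ _) (isClosed_prismHorn _ _ _)
      (u := fun z => z r - a r) (by fun_prop)
      (fun z hz => sub_nonneg.2 (hz.1 r hrk.ne))
      (fun z hz h => ⟨hz, r, hrk.ne, sub_eq_zero.1 h⟩) fun j => ?_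
    have hslab : {z ∈ prism k (insert r S) a | (j : ℝ) ≤ z r - a r ∧ z r - a r ≤ j + 1} =
        prism k S (Function.update a r (a r + j)) := by
      ext z
      simp only [prism, mem_ofPred_eq]
      constructor
      · rintro ⟨⟨h1, h2, h3⟩, h4, h5⟩
        refine ⟨fun i hi => ?_, fun i hi hiS => ?_, h3⟩
        · rcases eq_or_ne i r with rfl | hir
          · simp only [Function.update_self]; linarith
          · simpa [hir] using h1 i hi
        · rcases eq_or_ne i r with rfl | hir
          · simp only [Function.update_self]; linarith
          · simpa [hir] using h2 i hi (by simp [hir, hiS])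
      · rintro ⟨h1, h2, h3⟩
        have h4 := h1 r hrk.ne
        have h5 := h2 r hrk hr
        simp only [Function.update_self] at h4 h5
        refine ⟨⟨fun i hi => ?_, fun i hi hiS => ?_, h3⟩, by linarith, by linarith⟩
        · rcases eq_or_ne i r with rfl | hir
          · linarith
          · simpa [hir] using h1 i hi
        · rw [Finset.mem_insert, not_or] at hiS
          simpa [hiS.1] using h2 i hi hiS.2
    have hslabHorn : {z ∈ prism k (insert r S) a | (j : ℝ) ≤ z r - a r ∧ z r - a r ≤ j + 1 ∧
        (z ∈ prismHorn k (insert r S) a ∨ z r - a r = j)} =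
        prismHorn k S (Function.update a r (a r + j)) := by
      ext z
      change _ ↔ z ∈ prism k S _ ∧ ∃ i, i ≠ k ∧ z i = Function.update a r (a r + j) i
      rw [← hslab]
      constructor
      · rintro ⟨h1, h2, h3, h4⟩
        refine ⟨⟨h1, h2, h3⟩, ?_⟩
        rcases h4 with ⟨-, i, hi, hzi⟩ | h4
        · rcases eq_or_ne i r with rfl | hir
          · exact ⟨i, hi, by simp only [Function.update_self]; linarith⟩
          · exact ⟨i, hi, by simpa [hir] using hzi⟩
        · exact ⟨r, hrk.ne, by simp only [Function.update_self]; linarith⟩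
      · rintro ⟨⟨h1, h2, h3⟩, i, hi, hzi⟩
        refine ⟨h1, h2, h3, ?_⟩
        rcases eq_or_ne i r with rfl | hir
        · rw [Function.update_self] at hzi
          exact Or.inr (by linarith)
        · rw [Function.update_of_ne hir] at hzi
          exact Or.inl ⟨h1, i, hi, hzi⟩
    rw [hslab, hslabHorn]
    refine ih (fun i hi => hS i (Finset.mem_insert_of_mem hi)) fun i hi => ?_
    rw [Function.update_of_ne (hrk.trans hi).ne', ha i hi]

/-! ### The simplex with its initial face removed -/

lemma maxSupp_eq_topIndex {n : ℕ} {k : Fin (n + 1)} {x : stdSimplex ℝ (Fin (n + 1))}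
    (h : 0 < ∑ i ∈ Finset.Ici k, (x : Fin (n + 1) → ℝ) i) : maxSupp x = topIndex k x := by
  obtain ⟨i, hi, hxi⟩ := Finset.exists_lt_of_sum_lt (f := fun _ => (0 : ℝ)) (by simpa using h)
  rw [← maxSupp_sup, sup_eq_left.2 ((Finset.mem_Ici.1 hi).trans (le_maxSupp x hxi))]

lemma topIndex_smul {n : ℕ} {k : Fin (n + 1)} {c : ℝ} (hc : 0 < c) (z : Fin (n + 1) → ℝ) :
    topIndex k (c • z) = topIndex k z :=
  topIndex_congr fun i _ => by simp [hc]

lemma stratExtends_simplex {P X : Type*} [TopologicalSpace X] [Nonempty X] {s : X → P}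
    {n : ℕ} {J : Fin (n + 1) → P} {k : Fin (n + 1)}
    (hfill : HornFilling s (fun i => J (i ⊔ k)) k) :
    StratExtends s (fun x => J (topIndex k x))
      {x | (x ∈ stdSimplex ℝ (Fin (n + 1)) ∧ 0 < ∑ i ∈ Finset.Ici k, x i) ∧ ∃ i, i ≠ k ∧ x i = 0}
      {x | x ∈ stdSimplex ℝ (Fin (n + 1)) ∧ 0 < ∑ i ∈ Finset.Ici k, x i} := by
  intro h hh hhs
  have hpos : ∀ z ∈ prism k (Finset.Iio k) 0, (∀ i, 0 ≤ z i) ∧ 1 ≤ ∑ i, z i := by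
    rintro z ⟨h1, -, h2, h3⟩
    have h0 : ∀ i, 0 ≤ z i := fun i => by
      rcases eq_or_ne i k with rfl | hi
      · exact h2
      · exact h1 i hi
    exact ⟨h0, h3 ▸ Finset.sum_le_univ_sum_of_nonneg h0⟩
  have hmap : MapsTo (fun z : Fin (n + 1) → ℝ => (∑ i, z i)⁻¹ • z)
      (prismHorn k (Finset.Iio k) 0) {x | (x ∈ stdSimplex ℝ (Fin (n + 1)) ∧
        0 < ∑ i ∈ Finset.Ici k, x i) ∧ ∃ i, i ≠ k ∧ x i = 0} := by
    rintro z ⟨hz, i, hi, hzi⟩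
    obtain ⟨h0, h1⟩ := hpos z hz
    have hinv : 0 < (∑ i, z i)⁻¹ := inv_pos.2 (by linarith)
    refine ⟨⟨⟨fun j => mul_nonneg hinv.le (h0 j), ?_⟩, ?_⟩, i, hi, ?_⟩
    · simp only [Pi.smul_apply, smul_eq_mul, ← Finset.mul_sum]
      exact inv_mul_cancel₀ (by linarith)
    · simp only [Pi.smul_apply, smul_eq_mul, ← Finset.mul_sum, hz.2.2.2, mul_one]
      exact hinv
    · simp [hzi]
  have hnorm : ContinuousOn (fun z : Fin (n + 1) → ℝ => (∑ i, z i)⁻¹ • z)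
      (prismHorn k (Finset.Iio k) 0) := by
    have hsum : Continuous fun z : Fin (n + 1) → ℝ => ∑ i, z i := by fun_prop
    refine ContinuousOn.smul (hsum.continuousOn.inv₀ fun z hz => ?_) continuousOn_id
    linarith [(hpos z hz.1).2]
  obtain ⟨g, hg, hgs, hgh⟩ := stratExtends_prism hfill (Finset.Iio k) (by simp)
    (a := 0) (by simp) (fun z => h ((∑ i, z i)⁻¹ • z)) (hh.comp hnorm hmap) fun z hz => by
      refine (hhs _ (hmap hz)).trans ?_
      exact congrArg J (topIndex_smul (inv_pos.2 (by linarith [(hpos z hz.1).2])) z)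
  have hmem : ∀ x ∈ stdSimplex ℝ (Fin (n + 1)), 0 < ∑ i ∈ Finset.Ici k, x i →
      (∑ i ∈ Finset.Ici k, x i)⁻¹ • x ∈ prism k (Finset.Iio k) 0 := by
    intro x hx ht
    have hinv := inv_pos.2 ht
    refine ⟨fun i _ => mul_nonneg hinv.le (hx.1 i),
      fun i hi hi' => absurd (Finset.mem_Iio.2 hi) hi', mul_nonneg hinv.le (hx.1 k), ?_⟩
    simp only [Pi.smul_apply, smul_eq_mul, ← Finset.mul_sum]
    exact inv_mul_cancel₀ ht.ne'
  refine ⟨fun x => g ((∑ i ∈ Finset.Ici k, x i)⁻¹ • x), ?_, ?_, ?_⟩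
  · have hsum : Continuous fun x : Fin (n + 1) → ℝ => ∑ i ∈ Finset.Ici k, x i := by fun_prop
    exact hg.comp ((hsum.continuousOn.inv₀ fun x hx => hx.2.ne').smul continuousOn_id)
      fun x hx => hmem x hx.1 hx.2
  · rintro x ⟨hx, ht⟩
    refine (hgs _ (hmem x hx ht)).trans ?_
    exact congrArg J (topIndex_smul (inv_pos.2 ht) x)
  · rintro x ⟨⟨hx, ht⟩, i, hi, hxi⟩
    refine (hgh ⟨hmem x hx ht, i, hi, by simp [hxi]⟩).trans (congrArg h ?_)
    simp only [Pi.smul_apply, smul_eq_mul, ← Finset.mul_sum, hx.2, mul_one, inv_inv]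
    exact smul_inv_smul₀ ht.ne' x

/-! ### Pushing the simplex towards its horn -/

/-- Move `x` by `c` in the direction from the barycenter of the `k`-th face to the `k`-th vertex. -/
def pushToHorn {n : ℕ} (k : Fin (n + 1)) (c : ℝ) (x : Fin (n + 1) → ℝ) : Fin (n + 1) → ℝ :=
  fun i => x i + c * (if i = k then (n : ℝ) else -1)

lemma pushToHorn_zero {n : ℕ} (k : Fin (n + 1)) (x : Fin (n + 1) → ℝ) :
    pushToHorn k 0 x = x := by
  ext i
  simp [pushToHorn]

lemma pushToHorn_of_ne {n : ℕ} {k i : Fin (n + 1)} (hi : i ≠ k) (c : ℝ) (x : Fin (n + 1) → ℝ) :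
    pushToHorn k c x i = x i - c := by
  simp [pushToHorn, hi, sub_eq_add_neg]

lemma continuous_pushToHorn {n : ℕ} (k : Fin (n + 1)) :
    Continuous fun p : ℝ × (Fin (n + 1) → ℝ) => pushToHorn k p.1 p.2 := by
  unfold pushToHorn
  fun_prop

lemma pushToHorn_mem {n : ℕ} {k : Fin (n + 1)} {c : ℝ} {x : Fin (n + 1) → ℝ}
    (hx : x ∈ stdSimplex ℝ (Fin (n + 1))) (hc : 0 ≤ c) (hcx : ∀ i, i ≠ k → c ≤ x i) :
    pushToHorn k c x ∈ stdSimplex ℝ (Fin (n + 1)) := by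
  refine ⟨fun i => ?_, ?_⟩
  · rcases eq_or_ne i k with rfl | hi
    · have := hx.1 i
      simp only [pushToHorn, if_true]
      positivity
    · rw [pushToHorn_of_ne hi]
      linarith [hcx i hi]
  · have : ∑ i : Fin (n + 1), (if i = k then (n : ℝ) else -1) = 0 := by
      rw [← Finset.add_sum_erase _ _ (Finset.mem_univ k),
        Finset.sum_congr rfl fun i hi => if_neg (Finset.ne_of_mem_erase hi)]
      simp
    simp only [pushToHorn, Finset.sum_add_distrib, ← Finset.mul_sum, this, hx.2, mul_zero,
      add_zero]

lemma sum_Ici_le_pushToHorn {n : ℕ} (k : Fin (n + 1)) {c : ℝ} (hc : 0 ≤ c)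
    (x : Fin (n + 1) → ℝ) :
    ∑ i ∈ Finset.Ici k, x i ≤ ∑ i ∈ Finset.Ici k, pushToHorn k c x i := by
  have : 0 ≤ ∑ i ∈ Finset.Ici k, (if i = k then (n : ℝ) else -1) := by
    rw [sum_Ici_eq_add,
      Finset.sum_congr rfl fun i hi => if_neg (Finset.mem_Ioi.1 hi).ne']
    simp only [if_true, Finset.sum_const, Fin.card_Ioi, nsmul_eq_mul]
    have : ((n + 1 - 1 - (k : ℕ) : ℕ) : ℝ) ≤ n := by
      exact_mod_cast (by omega : n + 1 - 1 - (k : ℕ) ≤ n)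
    linarith
  simp only [pushToHorn, Finset.sum_add_distrib, ← Finset.mul_sum]
  have := mul_nonneg hc this
  linarith

lemma exists_continuous_min {n : ℕ} (hn : 0 < n) (k : Fin (n + 1)) :
    ∃ m : (Fin (n + 1) → ℝ) → ℝ, Continuous m ∧ (∀ x i, i ≠ k → m x ≤ x i) ∧
      ∀ x, ∃ i, i ≠ k ∧ m x = x i := by
  have hne : (Finset.univ.erase k).Nonempty := by
    rw [← Finset.card_pos, Finset.card_erase_of_mem (Finset.mem_univ k)]
    simpa using hn
  refine ⟨fun x => (Finset.univ.erase k).inf' hne x, ?_, fun x i hi => ?_, fun x => ?_⟩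
  · exact Continuous.finset_inf'_apply hne fun i _ => continuous_apply i
  · exact Finset.inf'_le _ (by simpa using hi)
  · obtain ⟨i, hi, h⟩ := Finset.exists_mem_eq_inf' hne x
    exact ⟨i, Finset.ne_of_mem_erase hi, h⟩

lemma exists_continuous_forall_dist_lt {Y X : Type*} [TopologicalSpace Y] [NormalSpace Y]
    [ParacompactSpace Y] [PseudoMetricSpace X] {F : Y × ℝ → X} (hF : Continuous F) {ε : Y → ℝ}
    (hε : Continuous ε) (hε0 : ∀ y, 0 < ε y) :
    ∃ φ : C(Y, ℝ), ∀ y, 0 < φ y ∧ φ y ≤ 1 ∧ dist (F (y, φ y)) (F (y, 0)) < ε y := by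
  obtain ⟨φ, hφ⟩ := exists_continuous_forall_mem_convex_of_local_const
    (t := fun y => {s : ℝ | 0 < s ∧ s ≤ 1 ∧ ∀ r ∈ Icc 0 s, dist (F (y, r)) (F (y, 0)) < ε y})
    (fun y => by
      refine OrdConnected.convex ⟨fun a ha b hb c hc => ?_⟩
      exact ⟨ha.1.trans_le hc.1, hc.2.trans hb.2.1,
        fun r hr => hb.2.2 r ⟨hr.1, hr.2.trans hc.2⟩⟩)
    (fun y => by
      have hev : ∀ᶠ p : Y × ℝ in nhds (y, 0), dist (F p) (F (p.1, 0)) < ε p.1 :=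
        ContinuousAt.eventually_lt (by fun_prop) (by fun_prop) (by simpa using hε0 y)
      rw [nhds_prod_eq, Filter.eventually_prod_iff] at hev
      obtain ⟨p, hp, q, hq, hpq⟩ := hev
      obtain ⟨δ, hδ, hball⟩ := Metric.eventually_nhds_iff.1 hq
      refine ⟨min 1 (δ / 2), hp.mono fun z hz =>
        ⟨lt_min one_pos (by linarith), min_le_left _ _, fun r hr => hpq hz (hball ?_)⟩⟩
      rw [Real.dist_0_eq_abs, abs_of_nonneg hr.1]
      linarith [hr.2.trans (min_le_right _ _)])
  exact ⟨φ, fun y => ⟨(hφ y).1, (hφ y).2.1, (hφ y).2.2 _ ⟨(hφ y).1.le, le_rfl⟩⟩⟩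

lemma HornFilling.of_subtype {P X : Type*} [TopologicalSpace X] {s : X → P} {Q : Set P} {n : ℕ}
    {J : Fin (n + 1) → P} {k : Fin (n + 1)} (hJQ : ∀ i, J i ∈ Q)
    (h : HornFilling (fun x : {x : X // s x ∈ Q} => (⟨s x.1, x.2⟩ : Q))
      (fun i => (⟨J i, hJQ i⟩ : Q)) k) : HornFilling s J k := by
  intro f hf hfs
  have hfQ : ∀ y, s (f y) ∈ Q := fun y => hfs y ▸ hJQ _
  obtain ⟨g, hg, hgs, hgf⟩ := h (fun y => ⟨f y, hfQ y⟩) (hf.subtype_mk hfQ)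
    fun y => Subtype.ext (hfs y)
  exact ⟨fun x => (g x).1, continuous_subtype_val.comp hg,
    fun x => congrArg Subtype.val (hgs x), fun y => congrArg Subtype.val (hgf y)⟩

/-- In a metrizable space, a horn filling property for the flag `i ↦ J (i ⊔ k)` implies the one
for `J`: a filling away from the initial face is reparametrized to be close to the horn. -/
lemma HornFilling.of_sup {P X : Type*} [TopologicalSpace X] [TopologicalSpace.MetrizableSpace X]
    {s : X → P} {n : ℕ} {J : Fin (n + 1) → P} {k : Fin (n + 1)} (hkn : (k : ℕ) < n)
    (hfill : HornFilling s (fun i => J (i ⊔ k)) k) : HornFilling s J k := by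
  let _ := TopologicalSpace.metrizableSpaceMetric X
  classical
  intro f hf hfs
  have hlast : Fin.last n ≠ k := fun h => by simp [← h] at hkn
  let Δ := stdSimplex ℝ (Fin (n + 1))
  let w : (Fin (n + 1) → ℝ) → ℝ := fun x => ∑ i ∈ Finset.Ici k, x i
  have hw : Continuous w := by fun_prop
  let H : Set (Fin (n + 1) → ℝ) := {x | x ∈ Δ ∧ ∃ i, i ≠ k ∧ x i = 0}
  obtain ⟨v, hv⟩ : ∃ v : Δ, v ∈ hornSet n k :=
    ⟨⟨Pi.single k 1, single_mem_stdSimplex ℝ k⟩, Fin.last n, hlast, by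
      exact Pi.single_eq_of_ne hlast 1⟩
  have : Nonempty X := ⟨f ⟨v, hv⟩⟩
  obtain ⟨f₁, hf₁, hf₁f⟩ := exists_continuousOn_eq hf
  obtain ⟨f₂, hf₂, hf₂f⟩ := exists_continuousOn_eq (A := H)
    (f := fun x => f₁ ⟨x.1, x.2.1⟩)
    (hf₁.comp_continuous (continuous_subtype_val.subtype_mk fun x => x.2.1) fun x => x.2.2)
  have hf₂eq : ∀ y : hornSet n k, f₂ y.1 = f y := fun y =>
    (hf₂f ⟨y.1.1, y.1.2, y.2⟩).trans (hf₁f y)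
  obtain ⟨G, hG, hGs, hGf⟩ := stratExtends_simplex hfill f₂ (hf₂.mono fun x hx => ⟨hx.1.1, hx.2⟩)
    fun x hx => by
      refine (congrArg s (hf₂eq ⟨⟨x, hx.1.1⟩, hx.2⟩)).trans ((hfs _).trans ?_)
      exact congrArg J (maxSupp_eq_topIndex (x := ⟨x, hx.1.1⟩) hx.1.2)
  obtain ⟨m, hm, hmle, hmeq⟩ := exists_continuous_min (Nat.zero_lt_of_lt hkn) k
  have hm0 : ∀ x ∈ Δ, 0 ≤ m x := fun x hx => by
    obtain ⟨i, -, hi⟩ := hmeq x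
    exact hi ▸ hx.1 i
  let R : (Fin (n + 1) → ℝ) → ℝ → Fin (n + 1) → ℝ := fun x r => pushToHorn k ((1 - r) * m x) x
  have hR : Continuous fun p : (Fin (n + 1) → ℝ) × ℝ => R p.1 p.2 :=
    (continuous_pushToHorn k).comp (by fun_prop :
      Continuous fun p : (Fin (n + 1) → ℝ) × ℝ => ((1 - p.2) * m p.1, p.1))
  have hRmem : ∀ x ∈ Δ, ∀ r ∈ Icc (0 : ℝ) 1, R x r ∈ Δ := fun x hx r hr =>
    pushToHorn_mem hx (mul_nonneg (by linarith [hr.2]) (hm0 x hx)) fun i hi => by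
      nlinarith [hmle x i hi, hm0 x hx, hr.1]
  have hRw : ∀ x ∈ Δ, ∀ r ∈ Icc (0 : ℝ) 1, w x ≤ w (R x r) := fun x hx r hr =>
    sum_Ici_le_pushToHorn k (mul_nonneg (by linarith [hr.2]) (hm0 x hx)) x
  have hR0 : ∀ x ∈ Δ, R x 0 ∈ H := fun x hx => by
    obtain ⟨i, hi, hxi⟩ := hmeq x
    exact ⟨hRmem x hx 0 (by simp), i, hi, by simp [R, pushToHorn_of_ne hi, hxi]⟩
  have hRfix : ∀ x, m x = 0 → ∀ r, R x r = x := fun x hx r => by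
    simp [R, hx, pushToHorn_zero]
  have hmH : ∀ x ∈ H, m x = 0 := fun x hx => by
    obtain ⟨hxΔ, i, hi, hxi⟩ := hx
    exact le_antisymm (hxi ▸ hmle x i hi) (hm0 x hxΔ)
  have hRtop : ∀ x ∈ Δ, ∀ r, 0 < r → r ≤ 1 → topIndex k (R x r) = topIndex k x := by
    intro x hx r hr hr1
    rcases (hm0 x hx).eq_or_lt with h | h
    · rw [hRfix x h.symm]
    · refine topIndex_congr fun i hi => ?_
      have := hmle x i hi.ne'
      simp only [R, pushToHorn_of_ne hi.ne']
      constructor <;> intro _ <;> nlinarith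
  have hwH : ∀ x ∈ Δ, w x ≤ 0 → x ∈ H := fun x hx h => by
    refine ⟨hx, Fin.last n, hlast, le_antisymm (le_trans ?_ h) (hx.1 _)⟩
    exact Finset.single_le_sum (f := x) (fun i _ => hx.1 i) (Finset.mem_Ici.2 (Fin.le_last k))
  let O : Set Δ := {x | 0 < w x}
  let clamp : ℝ → ℝ := fun r => max 0 (min r 1)
  have hclamp : ∀ r, clamp r ∈ Icc (0 : ℝ) 1 := fun r =>
    ⟨le_max_left _ _, max_le zero_le_one (min_le_right _ _)⟩
  have hclampEq : ∀ r, 0 ≤ r → r ≤ 1 → clamp r = r := fun r h0 h1 => by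
    simp [clamp, h0, h1]
  let F : O × ℝ → X := fun p => G (R p.1.1 (clamp p.2))
  have hF : Continuous F := by
    refine hG.comp_continuous (hR.comp (by fun_prop :
      Continuous fun p : O × ℝ => ((p.1.1 : Fin (n + 1) → ℝ), clamp p.2))) fun p => ?_
    exact ⟨hRmem _ p.1.1.2 _ (hclamp _), p.1.2.trans_le (hRw _ p.1.1.2 _ (hclamp _))⟩
  obtain ⟨φ, hφ⟩ := exists_continuous_forall_dist_lt hF (ε := fun y => w y.1)
    (hw.comp (continuous_subtype_val.comp continuous_subtype_val)) fun y => y.2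
  have hwΔ : Continuous fun x : Δ => w x := hw.comp continuous_subtype_val
  let g : Δ → X := fun x => if h : 0 < w x then F (⟨x, h⟩, φ ⟨x, h⟩) else f₂ x
  have hgpos : ∀ x : O, g x.1 = F (x, φ x) := fun x => dif_pos x.2
  have hgH : ∀ x : Δ, x.1 ∈ H → g x = f₂ x := by
    intro x hx
    by_cases h : 0 < w x
    · rw [hgpos ⟨x, h⟩]
      refine (congrArg G (hRfix _ (hmH _ hx) _)).trans ?_
      exact hGf ⟨⟨x.2, h⟩, hx.2⟩
    · exact dif_neg h
  have hgdist : ∀ x : Δ, dist (g x) (f₂ (R x 0)) ≤ w x := by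
    intro x
    by_cases h : 0 < w x
    · have h1 := (hφ ⟨x, h⟩).2.2
      have h2 : F (⟨x, h⟩, 0) = f₂ (R x 0) := by
        have : clamp 0 = 0 := hclampEq 0 le_rfl zero_le_one
        simp only [F, this]
        exact hGf ⟨⟨(hR0 x x.2).1, h.trans_le (hRw x x.2 0 (by simp))⟩, (hR0 x x.2).2⟩
      rw [h2] at h1
      rw [hgpos ⟨x, h⟩]
      exact h1.le
    · have hxH := hwH x x.2 (not_lt.1 h)
      rw [hgH x hxH, hRfix _ (hmH _ hxH), dist_self]
      exact Finset.sum_nonneg fun i _ => x.2.1 i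
  have hf₂R : Continuous fun x : Δ => f₂ (R x 0) :=
    hf₂.comp_continuous (hR.comp (by fun_prop :
      Continuous fun x : Δ => ((x : Fin (n + 1) → ℝ), (0 : ℝ)))) fun x => hR0 x x.2
  refine ⟨g, ?_, fun x => ?_, fun y => ?_⟩
  · refine continuous_iff_continuousAt.2 fun x => ?_
    by_cases h : 0 < w x
    · have hopen : IsOpen {x : Δ | 0 < w x} := isOpen_lt continuous_const hwΔ
      refine ContinuousOn.continuousAt (s := {x : Δ | 0 < w x}) ?_ (hopen.mem_nhds h)
      refine continuousOn_iff_continuous_domRestrict.2 ?_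
      refine (hF.comp (by fun_prop : Continuous fun x : O => (x, φ x))).congr fun x => ?_
      exact (hgpos x).symm
    · have hxH := hwH x x.2 (not_lt.1 h)
      have hw0 : w x = 0 := le_antisymm (not_lt.1 h) (Finset.sum_nonneg fun i _ => x.2.1 i)
      have h1 : Filter.Tendsto (fun y : Δ => f₂ (R y 0)) (nhds x) (nhds (g x)) := by
        rw [hgH x hxH]
        have := hf₂R.tendsto x
        rwa [hRfix _ (hmH _ hxH)] at this
      refine h1.congr_dist ?_
      refine squeeze_zero (fun _ => dist_nonneg) (fun y => ?_) (hw0 ▸ hwΔ.tendsto x)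
      rw [dist_comm]
      exact hgdist y
  · by_cases h : 0 < w x
    · obtain ⟨h0, h1, -⟩ := hφ ⟨x, h⟩
      rw [hgpos ⟨x, h⟩, flagStrat, maxSupp_eq_topIndex h]
      simp only [F, hclampEq _ h0.le h1]
      have hr : φ ⟨x, h⟩ ∈ Icc (0 : ℝ) 1 := ⟨h0.le, h1⟩
      refine (hGs _ ⟨hRmem x x.2 _ hr, h.trans_le (hRw x x.2 _ hr)⟩).trans ?_
      exact congrArg J (hRtop x x.2 _ h0 h1)
    · have hxH := hwH x x.2 (not_lt.1 h)
      rw [hgH x hxH, hf₂eq ⟨x, hxH.2⟩]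
      exact hfs _
  · rw [hgH y.1 ⟨y.1.2, y.2⟩, hf₂eq y]

/-- **Reduction lemma.** Let `X` be a metrizable stratified space over `P`,
`J = [p_0 ≤ ⋯ ≤ p_n]` a flag in `P` and `0 < k < n`. Let `Q = {p_i : k ≤ i ≤ n}`.
If the stratified subspace `X_Q = s⁻¹(Q)` (with the induced stratification over `Q`)
is categorically fibrant, then `X` has the horn filling property for `(J, k)`. -/
theorem metric_reduction_lemma {P : Type} [PartialOrder P] {X : Type} [TopologicalSpace X]
    [TopologicalSpace.MetrizableSpace X] (s : X → P) (hs : AlexContinuous s)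
    {n : ℕ} (J : Fin (n + 1) → P) (hJ : Monotone J) (k : Fin (n + 1))
    (hk : 0 < (k : ℕ)) (hkn : (k : ℕ) < n)
    (Q : Set P) (hQ : Q = {r : P | ∃ i : Fin (n + 1), (k : ℕ) ≤ (i : ℕ) ∧ J i = r})
    (hfib : CatFibrant (fun x : {x : X // s x ∈ Q} => (⟨s x.1, x.2⟩ : Q))) :
    HornFilling s J k := by
  have hJQ : ∀ i, J (i ⊔ k) ∈ Q := fun i => hQ ▸ ⟨i ⊔ k, le_sup_right, rfl⟩
  refine HornFilling.of_sup hkn (HornFilling.of_subtype hJQ ?_)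
  exact hfib n _ (fun i j hij => hJ (sup_le_sup_right hij k)) k ⟨hk, hkn⟩
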